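/- (Beckner inequality for the multislice.) For every p ∈ (1, 2] and every nonnegative function f : Ω_κ → ℝ, E_κ[f^p] − (E_κ f)^p ≤ (β_p p / 2) · ℰ_κ(f, f^{p−1}) with β_p = 4N / (p(N+2)); equivalently, E_κ[f^p] − (E_κ f)^p ≤ (2N/(N+2)) · ℰ_κ(f, f^{p−1}). -/

import Mathlib

open Finset Real
open scoped Classical

noncomputable section

/-- The multislice `Ω_κ ⊆ 𝒳^N`: vectors with values in `{x ℓ}` where the value `x ℓ`
appears exactly `κ ℓ` times. -/
def multislice (L N : ℕ) (κ : Fin L → ℕ) (x : Fin L → ℝ) : Finset (Fin N → ℝ) :=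
  (Fintype.piFinset fun _ : Fin N => Finset.image x Finset.univ).filter
    (fun ω => ∀ ℓ : Fin L, (Finset.univ.filter fun i => ω i = x ℓ).card = κ ℓ)

/-- Expectation with respect to the uniform distribution on a finite set. -/
def uexpect {α : Type*} (Ω : Finset α) (f : α → ℝ) : ℝ := (∑ ω ∈ Ω, f ω) / Ω.card

/-- Probability of an event with respect to the uniform distribution on a finite set. -/
def uprob {α : Type*} (Ω : Finset α) (p : α → Prop) : ℝ :=
  ((Ω.filter p).card : ℝ) / Ω.card

/-- The Dirichlet form `ℰ_κ(f,g) = (1/(2N)) ∑_{i<j} E_κ[(Γ_ij f)(Γ_ij g)]` on the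
multislice. -/
def msDirichlet (L N : ℕ) (κ : Fin L → ℕ) (x : Fin L → ℝ)
    (f g : (Fin N → ℝ) → ℝ) : ℝ :=
  (1 / (2 * (N : ℝ))) * ∑ q ∈ (Finset.univ : Finset (Fin N × Fin N)).filter
    (fun q => q.1 < q.2),
    uexpect (multislice L N κ x)
      (fun ω => (f ω - f (ω ∘ Equiv.swap q.1 q.2)) * (g ω - g (ω ∘ Equiv.swap q.1 q.2)))

/-- The integrand `(x - y)(x^r - y^r)` of the Dirichlet form `ℰ(f, f^r)`. -/
def becknerGap (r : ℝ) (z : ℝ × ℝ) : ℝ := (z.1 - z.2) * (z.1 ^ r - z.2 ^ r)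

theorem becknerGap_self (r x : ℝ) : becknerGap r (x, x) = 0 := by simp [becknerGap]

theorem continuous_becknerGap {r : ℝ} (hr : 0 < r) : Continuous (becknerGap r) := by
  unfold becknerGap
  have h := Real.continuous_rpow_const hr.le
  exact (continuous_fst.sub continuous_snd).mul
    ((h.comp continuous_fst).sub (h.comp continuous_snd))

theorem rpow_sub_one_le_mul {r x y : ℝ} (hr : 0 < r) (hr1 : r ≤ 1) (hx : 0 < x) (hy : 0 < y) :
    x ^ (r - 1) ≤ y ^ (r - 1) * (r + (1 - r) * (y / x)) := by
  have h := Real.geom_mean_le_arith_mean2_weighted hr.le (by linarith : 0 ≤ 1 - r) hx.le hy.le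
    (by ring)
  have e1 : x ^ r = x ^ (r - 1) * x := by
    rw [← Real.rpow_add_one hx.ne']; congr 1; ring
  have e2 : y ^ (1 - r) * y ^ (r - 1) = 1 := by
    rw [← Real.rpow_add hy]; simp
  have hB : 0 < y ^ (r - 1) := Real.rpow_pos_of_pos hy _
  rw [e1] at h
  have h2 := mul_le_mul_of_nonneg_left h hB.le
  have h3 : x ^ (r - 1) * x ≤ y ^ (r - 1) * (r * x + (1 - r) * y) := by
    calc x ^ (r - 1) * x = y ^ (r - 1) * (x ^ (r - 1) * x * y ^ (1 - r)) := by
          linear_combination (-(x ^ (r - 1) * x)) * e2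
      _ ≤ _ := h2
  calc x ^ (r - 1) = x ^ (r - 1) * x / x := by field_simp
    _ ≤ y ^ (r - 1) * (r * x + (1 - r) * y) / x := by gcongr
    _ = _ := by field_simp

theorem becknerGap_second_deriv_nonneg {r x y : ℝ} (hr : 0 < r) (hr1 : r ≤ 1) (hx : 0 < x)
    (hy : 0 < y) (α β : ℝ) :
    0 ≤ 2 * (α - β) * (α * r * x ^ (r - 1) - β * r * y ^ (r - 1)) +
      (x - y) * (α * r * (α * (r - 1) * x ^ (r - 1 - 1)) -
        β * r * (β * (r - 1) * y ^ (r - 1 - 1))) := by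
  have k1 := rpow_sub_one_le_mul hr hr1 hx hy
  have k2 := rpow_sub_one_le_mul hr hr1 hy hx
  have hA : 0 < x ^ (r - 1) := Real.rpow_pos_of_pos hx _
  have hB : 0 < y ^ (r - 1) := Real.rpow_pos_of_pos hy _
  rw [Real.rpow_sub_one hx.ne' (r - 1), Real.rpow_sub_one hy.ne' (r - 1)]
  generalize x ^ (r - 1) = A at *
  generalize y ^ (r - 1) = B at *
  have k1' : A / B ≤ r + (1 - r) * (y / x) := by
    rw [div_le_iff₀ hB]; linarith
  have k2' : B / A ≤ r + (1 - r) * (x / y) := by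
    rw [div_le_iff₀ hA]; linarith
  have e : 2 * (α - β) * (α * r * A - β * r * B) +
      (x - y) * (α * r * (α * (r - 1) * (A / x)) - β * r * (β * (r - 1) * (B / y))) =
      r * ((A + B) * (α * A - β * B) ^ 2 / (A * B) +
        α ^ 2 * A * (r + (1 - r) * (y / x) - A / B) +
        β ^ 2 * B * (r + (1 - r) * (x / y) - B / A)) := by
    field_simp
    ring
  rw [e]
  have := sub_nonneg.2 k1'
  have := sub_nonneg.2 k2'
  positivity

theorem becknerGap_convex_of_pos {r : ℝ} (hr : 0 < r) (hr1 : r ≤ 1) {x y u v s t : ℝ}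
    (hx : 0 < x) (hy : 0 < y) (hu : 0 < u) (hv : 0 < v) (hs : 0 ≤ s) (ht : 0 ≤ t)
    (hst : s + t = 1) :
    becknerGap r (s * x + t * u, s * y + t * v) ≤
      s * becknerGap r (x, y) + t * becknerGap r (u, v) := by
  let X : ℝ → ℝ := fun τ => x + τ * (u - x)
  let Y : ℝ → ℝ := fun τ => y + τ * (v - y)
  have hX : ∀ τ ∈ Set.Icc (0 : ℝ) 1, 0 < X τ := fun τ hτ => by
    have : X τ = (1 - τ) * x + τ * u := by simp only [X]; ring
    rw [this]
    rcases hτ.1.eq_or_lt with h | h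
    · subst h; simpa using hx
    · have := sub_nonneg.2 hτ.2; positivity
  have hY : ∀ τ ∈ Set.Icc (0 : ℝ) 1, 0 < Y τ := fun τ hτ => by
    have : Y τ = (1 - τ) * y + τ * v := by simp only [Y]; ring
    rw [this]
    rcases hτ.1.eq_or_lt with h | h
    · subst h; simpa using hy
    · have := sub_nonneg.2 hτ.2; positivity
  have dX : ∀ τ, HasDerivAt X (u - x) τ := fun τ => by
    simpa [X] using ((hasDerivAt_id τ).mul_const (u - x)).const_add x
  have dY : ∀ τ, HasDerivAt Y (v - y) τ := fun τ => by
    simpa [Y] using ((hasDerivAt_id τ).mul_const (v - y)).const_add y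
  have hc : ConvexOn ℝ (Set.Icc (0 : ℝ) 1) (fun τ => (X τ - Y τ) * (X τ ^ r - Y τ ^ r)) := by
    have hsub : interior (Set.Icc (0 : ℝ) 1) ⊆ Set.Icc (0 : ℝ) 1 := interior_subset
    have d1 : ∀ τ ∈ Set.Icc (0 : ℝ) 1,
        HasDerivAt (fun τ => (X τ - Y τ) * (X τ ^ r - Y τ ^ r)) _ τ := fun τ hτ =>
      ((dX τ).sub (dY τ)).mul (((dX τ).rpow_const (p := r) (Or.inl (hX τ hτ).ne')).sub
        ((dY τ).rpow_const (p := r) (Or.inl (hY τ hτ).ne')))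
    refine convexOn_of_hasDerivWithinAt2_nonneg (convex_Icc 0 1)
      (fun τ hτ => (d1 τ hτ).continuousAt.continuousWithinAt)
      (fun τ hτ => (d1 τ (hsub hτ)).hasDerivWithinAt)
      (fun τ hτ => HasDerivAt.hasDerivWithinAt
        ((((((dX τ).rpow_const (p := r) (Or.inl (hX τ (hsub hτ)).ne')).sub
        ((dY τ).rpow_const (p := r) (Or.inl (hY τ (hsub hτ)).ne'))).const_mul
          ((u - x) - (v - y))).add
        (((dX τ).sub (dY τ)).mul
          ((((dX τ).rpow_const (p := r - 1) (Or.inl (hX τ (hsub hτ)).ne')).const_mul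
            ((u - x) * r)).sub
          (((dY τ).rpow_const (p := r - 1) (Or.inl (hY τ (hsub hτ)).ne')).const_mul
            ((v - y) * r)))))))
      (fun τ hτ => ?_)
    refine (becknerGap_second_deriv_nonneg hr hr1 (hX τ (hsub hτ)) (hY τ (hsub hτ))
      (u - x) (v - y)).trans_eq ?_
    simp only [Pi.sub_apply]
    ring
  have h := hc.2 (x := 0) (y := 1) (by simp) (by simp) hs ht hst
  have hX' : X t = s * x + t * u := by simp only [X]; linear_combination (-x) * hst
  have hY' : Y t = s * y + t * v := by simp only [Y]; linear_combination (-y) * hst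
  simpa [becknerGap, hX', hY', X, Y] using h

theorem convexOn_becknerGap {r : ℝ} (hr : 0 < r) (hr1 : r ≤ 1) :
    ConvexOn ℝ (Set.Ici (0 : ℝ × ℝ)) (becknerGap r) := by
  refine ⟨convex_Ici _, ?_⟩
  rintro ⟨x, y⟩ ⟨hx, hy⟩ ⟨u, v⟩ ⟨hu, hv⟩ s t hs ht hst
  simp only [Prod.fst_zero, Prod.snd_zero] at hx hy hu hv
  have hg := continuous_becknerGap hr
  have hcl : IsClosed {ε : ℝ | becknerGap r (s * (x + ε) + t * (u + ε), s * (y + ε) + t * (v + ε))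
      ≤ s * becknerGap r (x + ε, y + ε) + t * becknerGap r (u + ε, v + ε)} :=
    isClosed_le (by fun_prop) (by fun_prop)
  have hmem : (0 : ℝ) ∈ closure (Set.Ioi (0 : ℝ)) := by rw [closure_Ioi]; simp
  have h0 := hcl.closure_subset_iff.2 (fun ε (hε : 0 < ε) =>
    becknerGap_convex_of_pos hr hr1 (by linarith : 0 < x + ε) (by linarith : 0 < y + ε)
      (by linarith : 0 < u + ε) (by linarith : 0 < v + ε) hs ht hst) hmem
  simpa using h0

theorem becknerGap_average_le {r : ℝ} (hr : 0 < r) (hr1 : r ≤ 1) {ι : Type*} [Fintype ι]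
    [Nonempty ι] (u v : ι → ℝ) (hu : ∀ i, 0 ≤ u i) (hv : ∀ i, 0 ≤ v i) :
    becknerGap r ((∑ i, u i) / Fintype.card ι, (∑ i, v i) / Fintype.card ι) ≤
      (∑ i, becknerGap r (u i, v i)) / Fintype.card ι := by
  have hc : (0 : ℝ) < Fintype.card ι := by exact_mod_cast Fintype.card_pos
  have h := (convexOn_becknerGap hr hr1).map_sum_le (t := Finset.univ)
    (w := fun _ : ι => (Fintype.card ι : ℝ)⁻¹) (p := fun i => (u i, v i))
    (fun _ _ => by positivity) (by simp [hc.ne']) (fun i _ => ⟨hu i, hv i⟩)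
  simpa only [Prod.smul_mk, ← prod_mk_sum, smul_eq_mul, ← div_eq_inv_mul, ← Finset.sum_div]
    using h

theorem sum_rpow_sub_le_sum_becknerGap {r : ℝ} (hr : 0 < r) (hr1 : r ≤ 1) {ι : Type*} [Fintype ι]
    [Nonempty ι] (h : ι → ℝ) (hh : ∀ i, 0 ≤ h i) :
    ∑ i, h i ^ (r + 1) - Fintype.card ι * ((∑ i, h i) / Fintype.card ι) ^ (r + 1) ≤
      1 / (2 * Fintype.card ι) * ∑ k, ∑ l, becknerGap r (h k, h l) := by
  have hc : (0 : ℝ) < Fintype.card ι := by exact_mod_cast Fintype.card_pos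
  have hp : ∀ x : ℝ, 0 ≤ x → x ^ (r + 1) = x * x ^ r := fun x hx => by
    rw [Real.rpow_add_one' hx (by linarith), mul_comm]
  have hS : 0 ≤ ∑ i, h i := Finset.sum_nonneg fun i _ => hh i
  have J := (Real.concaveOn_rpow hr.le hr1).le_map_sum (t := Finset.univ)
    (w := fun _ : ι => (Fintype.card ι : ℝ)⁻¹) (p := h)
    (fun _ _ => by positivity) (by simp [hc.ne']) (fun i _ => hh i)
  simp only [smul_eq_mul, ← div_eq_inv_mul, ← Finset.sum_div] at J
  have e : ∑ k, ∑ l, becknerGap r (h k, h l) =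
      2 * (Fintype.card ι * ∑ i, h i ^ (r + 1) - (∑ i, h i) * ∑ i, h i ^ r) := by
    have : ∀ k l, becknerGap r (h k, h l) =
        h k ^ (r + 1) + h l ^ (r + 1) - h k * h l ^ r - h k ^ r * h l := fun k l => by
      rw [hp _ (hh k), hp _ (hh l), becknerGap]; ring
    simp only [this, Finset.sum_sub_distrib, Finset.sum_add_distrib, ← Finset.mul_sum,
      ← Finset.sum_mul, Finset.sum_const, Finset.card_univ, nsmul_eq_mul]
    ring
  rw [e, hp _ (by positivity)]
  have J' := mul_le_mul_of_nonneg_left J hS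
  have e2 : (Fintype.card ι : ℝ) * ((∑ i, h i) / Fintype.card ι *
      ((∑ i, h i) / Fintype.card ι) ^ r) = (∑ i, h i) * ((∑ i, h i) / Fintype.card ι) ^ r := by
    field_simp
  have e3 : 1 / (2 * (Fintype.card ι : ℝ)) *
      (2 * (Fintype.card ι * ∑ i, h i ^ (r + 1) - (∑ i, h i) * ∑ i, h i ^ r)) =
      ∑ i, h i ^ (r + 1) - (∑ i, h i) * ((∑ i, h i ^ r) / Fintype.card ι) := by
    field_simp
  rw [e2, e3]
  linarith

/-- The sum over all permutations of the gap of `g` along right multiplication by `(a b)`. -/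
def permGap {n : ℕ} (r : ℝ) (g : Equiv.Perm (Fin n) → ℝ) (a b : Fin n) : ℝ :=
  ∑ σ, becknerGap r (g σ, g (σ * Equiv.swap a b))

theorem permGap_self {n : ℕ} (r : ℝ) (g : Equiv.Perm (Fin n) → ℝ) (a : Fin n) :
    permGap r g a a = 0 := by
  simp [permGap, Equiv.Perm.mul_def, becknerGap_self]

theorem permGap_comm {n : ℕ} (r : ℝ) (g : Equiv.Perm (Fin n) → ℝ) (a b : Fin n) :
    permGap r g a b = permGap r g b a := by
  simp [permGap, Equiv.swap_comm a b]

theorem permGap_mul_right {n : ℕ} (r : ℝ) (g : Equiv.Perm (Fin n) → ℝ) (s : Equiv.Perm (Fin n))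
    (a b : Fin n) : permGap r (fun σ => g (σ * s⁻¹)) a b = permGap r g (s a) (s b) := by
  unfold permGap
  refine Fintype.sum_equiv (Equiv.mulRight s⁻¹) _ _ fun σ => ?_
  simp only [Equiv.coe_mulRight]
  congr 3
  rw [mul_assoc σ, mul_assoc σ, ← mul_inv_eq_iff_eq_mul.2 (Equiv.mul_swap_eq_swap_mul s a b)]
  group

theorem sum_permGap_succ {n : ℕ} (r : ℝ) (g : Equiv.Perm (Fin (n + 1)) → ℝ) :
    ∑ a : Fin n, ∑ b : Fin n, permGap r g a.succ b.succ =
      ∑ a, ∑ b, permGap r g a b - 2 * ∑ b, permGap r g 0 b := by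
  simp only [Fin.sum_univ_succ, permGap_self, Finset.sum_add_distrib,
    permGap_comm r g _ 0]
  ring

theorem decomposeFin_symm_mul_swap {n : ℕ} (k : Fin (n + 1)) (e : Equiv.Perm (Fin n))
    (a b : Fin n) :
    Equiv.Perm.decomposeFin.symm (k, e * Equiv.swap a b) =
      Equiv.Perm.decomposeFin.symm (k, e) * Equiv.swap a.succ b.succ := by
  ext x
  refine Fin.cases ?_ (fun x => ?_) x
  · rw [Equiv.Perm.mul_apply, Equiv.swap_apply_of_ne_of_ne (Fin.succ_ne_zero a).symm
      (Fin.succ_ne_zero b).symm]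
    simp only [Equiv.Perm.decomposeFin_symm_apply_zero]
  · rw [Equiv.Perm.mul_apply, ← (Fin.succ_injective n).map_swap]
    simp only [Equiv.Perm.decomposeFin_symm_apply_succ, Equiv.Perm.mul_apply]

theorem sum_decomposeFin_eq {n : ℕ} (F : Equiv.Perm (Fin (n + 1)) → ℝ) :
    ∑ σ, F σ = ∑ k, ∑ e, F (Equiv.Perm.decomposeFin.symm (k, e)) := by
  rw [← Equiv.Perm.decomposeFin.symm.sum_comp, Fintype.sum_prod_type]

theorem sum_decomposeFin_fiber {n : ℕ} (F : Equiv.Perm (Fin (n + 1)) → ℝ) (k : Fin (n + 1)) :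
    ∑ e, F (Equiv.Perm.decomposeFin.symm (k, e)) = ∑ σ, if σ 0 = k then F σ else 0 := by
  rw [sum_decomposeFin_eq, Finset.sum_eq_single k]
  · simp
  · intro j _ hj
    simp [hj]
  · simp

theorem sum_decomposeFin_swap_mul {n : ℕ} (F : Equiv.Perm (Fin (n + 1)) → ℝ)
    (k l : Fin (n + 1)) :
    ∑ e, F (Equiv.swap k l * Equiv.Perm.decomposeFin.symm (k, e)) =
      ∑ e, F (Equiv.Perm.decomposeFin.symm (l, e)) := by
  rw [sum_decomposeFin_fiber (fun σ => F (Equiv.swap k l * σ)), sum_decomposeFin_fiber]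
  refine Fintype.sum_equiv (Equiv.mulLeft (Equiv.swap k l)) _ _ fun σ => ?_
  have : Equiv.swap k l (σ 0) = l ↔ σ 0 = k := by
    rw [Equiv.swap_apply_eq_iff, Equiv.swap_apply_right]
  simp [this]

/-- The first-coordinate conditional averages contribute only transpositions moving `0`. -/
theorem sum_becknerGap_average_le {n : ℕ} {r : ℝ} (hr : 0 < r) (hr1 : r ≤ 1)
    (g : Equiv.Perm (Fin (n + 1)) → ℝ) (hg : ∀ σ, 0 ≤ g σ) (h : Fin (n + 1) → ℝ)
    (hh : ∀ k, h k = (∑ e, g (Equiv.Perm.decomposeFin.symm (k, e))) / n.factorial) :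
    n.factorial * ∑ k, ∑ l, becknerGap r (h k, h l) ≤ ∑ b, permGap r g 0 b := by
  have hm : (0 : ℝ) < n.factorial := by exact_mod_cast n.factorial_pos
  have key : ∀ k l, n.factorial * becknerGap r (h k, h l) ≤
      ∑ e, becknerGap r (g (Equiv.Perm.decomposeFin.symm (k, e)),
        g (Equiv.swap k l * Equiv.Perm.decomposeFin.symm (k, e))) := fun k l => by
    have J := becknerGap_average_le hr hr1 (fun e => g (Equiv.Perm.decomposeFin.symm (k, e)))
      (fun e => g (Equiv.swap k l * Equiv.Perm.decomposeFin.symm (k, e)))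
      (fun _ => hg _) (fun _ => hg _)
    rw [sum_decomposeFin_swap_mul, Fintype.card_perm, Fintype.card_fin, ← hh, ← hh,
      le_div_iff₀ hm] at J
    linarith
  calc n.factorial * ∑ k, ∑ l, becknerGap r (h k, h l)
      ≤ ∑ k, ∑ l, ∑ e, becknerGap r (g (Equiv.Perm.decomposeFin.symm (k, e)),
        g (Equiv.swap k l * Equiv.Perm.decomposeFin.symm (k, e))) := by
        simp only [Finset.mul_sum]
        exact Finset.sum_le_sum fun k _ => Finset.sum_le_sum fun l _ => key k l
    _ = ∑ σ : Equiv.Perm (Fin (n + 1)), ∑ l, becknerGap r (g σ, g (Equiv.swap (σ 0) l * σ)) := by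
        rw [sum_decomposeFin_eq]
        refine Finset.sum_congr rfl fun k _ => ?_
        rw [Finset.sum_comm]
        simp only [Equiv.Perm.decomposeFin_symm_apply_zero]
    _ = ∑ σ : Equiv.Perm (Fin (n + 1)), ∑ b, becknerGap r (g σ, g (σ * Equiv.swap 0 b)) := by
        refine Finset.sum_congr rfl fun σ _ => ?_
        rw [← Equiv.sum_comp σ]
        simp only [Equiv.mul_swap_eq_swap_mul]
    _ = _ := by rw [Finset.sum_comm]; rfl

/-- The Beckner inequality on the symmetric group. -/
def PermBeckner (n : ℕ) (r : ℝ) : Prop :=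
  ∀ g : Equiv.Perm (Fin n) → ℝ, (∀ σ, 0 ≤ g σ) →
    ∑ σ, g σ ^ (r + 1) - n.factorial * ((∑ σ, g σ) / n.factorial) ^ (r + 1) ≤
      1 / (2 * (n + 2)) * ∑ a, ∑ b, permGap r g a b

theorem permBeckner_step {n : ℕ} {r : ℝ} (hr : 0 < r) (hr1 : r ≤ 1) (ih : PermBeckner n r)
    (g : Equiv.Perm (Fin (n + 1)) → ℝ) (hg : ∀ σ, 0 ≤ g σ) :
    ∑ σ, g σ ^ (r + 1) -
        (n + 1).factorial * ((∑ σ, g σ) / (n + 1).factorial) ^ (r + 1) ≤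
      1 / (2 * (n + 2)) * (∑ a, ∑ b, permGap r g a b - 2 * ∑ b, permGap r g 0 b) +
        1 / (2 * (n + 1)) * ∑ b, permGap r g 0 b := by
  have hm : (0 : ℝ) < n.factorial := by exact_mod_cast n.factorial_pos
  let h : Fin (n + 1) → ℝ := fun k =>
    (∑ e, g (Equiv.Perm.decomposeFin.symm (k, e))) / n.factorial
  have hh0 : ∀ k, 0 ≤ h k := fun k =>
    div_nonneg (Finset.sum_nonneg fun _ _ => hg _) hm.le
  have h1 : ∑ σ, g σ ^ (r + 1) - n.factorial * ∑ k, h k ^ (r + 1) ≤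
      1 / (2 * (n + 2)) * (∑ a, ∑ b, permGap r g a b - 2 * ∑ b, permGap r g 0 b) := by
    have hs := Finset.sum_le_sum fun k (_ : k ∈ Finset.univ) =>
      ih (fun e => g (Equiv.Perm.decomposeFin.symm (k, e))) fun _ => hg _
    rw [Finset.sum_sub_distrib, ← sum_decomposeFin_eq (fun σ => g σ ^ (r + 1)),
      ← Finset.mul_sum, ← Finset.mul_sum] at hs
    refine hs.trans_eq ?_
    rw [← sum_permGap_succ, Finset.sum_comm]
    congr 1
    refine Finset.sum_congr rfl fun a _ => ?_
    rw [Finset.sum_comm]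
    refine Finset.sum_congr rfl fun b _ => ?_
    simp only [permGap, decomposeFin_symm_mul_swap]
    rw [sum_decomposeFin_eq]
  have h2 := sum_becknerGap_average_le hr hr1 g hg h fun _ => rfl
  have h3 := sum_rpow_sub_le_sum_becknerGap hr hr1 h hh0
  have hsum : (∑ k, h k) / Fintype.card (Fin (n + 1)) = (∑ σ, g σ) / (n + 1).factorial := by
    simp only [h]
    rw [← Finset.sum_div, ← sum_decomposeFin_eq, div_div, Nat.factorial_succ, Fintype.card_fin,
      Nat.cast_mul, mul_comm]
  rw [hsum, Fintype.card_fin] at h3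
  push_cast at h3
  have h4 := mul_le_mul_of_nonneg_left h3 hm.le
  have h5 := mul_le_mul_of_nonneg_left h2 (by positivity : (0 : ℝ) ≤ 1 / (2 * (n + 1)))
  have hfac : ((n + 1).factorial : ℝ) = (n + 1) * n.factorial := by
    rw [Nat.factorial_succ]; push_cast; ring
  have e : ((n + 1).factorial : ℝ) * ((∑ σ, g σ) / (n + 1).factorial) ^ (r + 1) =
      n.factorial * ((n + 1) * ((∑ σ, g σ) / (n + 1).factorial) ^ (r + 1)) := by
    nth_rewrite 1 [hfac]; ring
  rw [e]
  nlinarith [h1, h4, h5]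

theorem permGap_nonneg {n : ℕ} {r : ℝ} (hr : 0 < r) (g : Equiv.Perm (Fin n) → ℝ)
    (hg : ∀ σ, 0 ≤ g σ) (a b : Fin n) : 0 ≤ permGap r g a b := by
  refine Finset.sum_nonneg fun σ _ => ?_
  simp only [becknerGap]
  rcases le_total (g σ) (g (σ * Equiv.swap a b)) with h | h
  · exact mul_nonneg_of_nonpos_of_nonpos (sub_nonpos.2 h)
      (sub_nonpos.2 (Real.rpow_le_rpow (hg _) h hr.le))
  · exact mul_nonneg (sub_nonneg.2 h) (sub_nonneg.2 (Real.rpow_le_rpow (hg _) h hr.le))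

theorem permBeckner_step_at {n : ℕ} {r : ℝ} (hr : 0 < r) (hr1 : r ≤ 1) (ih : PermBeckner n r)
    (g : Equiv.Perm (Fin (n + 1)) → ℝ) (hg : ∀ σ, 0 ≤ g σ) (i : Fin (n + 1)) :
    ∑ σ, g σ ^ (r + 1) -
        (n + 1).factorial * ((∑ σ, g σ) / (n + 1).factorial) ^ (r + 1) ≤
      1 / (2 * (n + 2)) * (∑ a, ∑ b, permGap r g a b - 2 * ∑ b, permGap r g i b) +
        1 / (2 * (n + 1)) * ∑ b, permGap r g i b := by
  have h := permBeckner_step hr hr1 ih (fun σ => g (σ * (Equiv.swap 0 i)⁻¹)) fun _ => hg _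
  have hrow : ∀ a : Fin (n + 1), ∑ b, permGap r g a (Equiv.swap 0 i b) = ∑ b, permGap r g a b :=
    fun a => Equiv.sum_comp (Equiv.swap 0 i) (permGap r g a)
  simp only [permGap_mul_right, Equiv.swap_apply_left, hrow] at h
  rw [Equiv.sum_comp (Equiv.swap 0 i) fun a => ∑ b, permGap r g a b,
    show ∑ σ, g (σ * (Equiv.swap 0 i)⁻¹) = _ from
      Equiv.sum_comp (Equiv.mulRight (Equiv.swap 0 i)⁻¹) g,
    show ∑ σ, g (σ * (Equiv.swap 0 i)⁻¹) ^ (r + 1) = _ from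
      Equiv.sum_comp (Equiv.mulRight (Equiv.swap 0 i)⁻¹) fun σ => g σ ^ (r + 1)] at h
  exact h

theorem permBeckner {r : ℝ} (hr : 0 < r) (hr1 : r ≤ 1) (n : ℕ) : PermBeckner n r := by
  induction n with
  | zero => intro g hg; simp
  | succ n ih =>
    intro g hg
    have hs := Finset.sum_le_sum fun i (_ : i ∈ (Finset.univ : Finset (Fin (n + 1)))) =>
      permBeckner_step_at hr hr1 ih g hg i
    simp only [Finset.sum_const, Finset.sum_add_distrib, ← Finset.mul_sum,
      Finset.sum_sub_distrib, Finset.card_univ, Fintype.card_fin, nsmul_eq_mul] at hs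
    have hT : 0 ≤ ∑ a, ∑ b, permGap r g a b :=
      Finset.sum_nonneg fun a _ => Finset.sum_nonneg fun b _ => permGap_nonneg hr g hg a b
    rcases n.eq_zero_or_pos with hn | hn
    · subst hn
      simp [permGap_self]
    generalize (∑ a, ∑ b, permGap r g a b) = T at *
    generalize (∑ σ, g σ ^ (r + 1) -
      (n + 1).factorial * ((∑ σ, g σ) / (n + 1).factorial) ^ (r + 1)) = S at *
    have hn' : (1 : ℝ) ≤ n := by exact_mod_cast hn
    push_cast at hs ⊢
    have h1 : S ≤
        (1 / (2 * (n + 2)) * ((n + 1) * T - 2 * T) + 1 / (2 * (n + 1)) * T) / (n + 1) := by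
      rw [le_div_iff₀ (by positivity)]; linarith
    refine h1.trans ?_
    have e : 1 / (2 * ((n : ℝ) + 1 + 2)) * T -
        (1 / (2 * (n + 2)) * ((n + 1) * T - 2 * T) + 1 / (2 * (n + 1)) * T) / (n + 1) =
        T * (n - 1) / (2 * (n + 3) * (n + 2) * (n + 1) ^ 2) := by
      field_simp
      ring
    have : 0 ≤ T * (n - 1) / (2 * (n + 3) * (n + 2) * ((n : ℝ) + 1) ^ 2) := by
      have := sub_nonneg.2 hn'
      positivity
    linarith

theorem mem_multislice_comp {L N : ℕ} {κ : Fin L → ℕ} {x : Fin L → ℝ} {ω : Fin N → ℝ}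
    (hω : ω ∈ multislice L N κ x) (σ : Equiv.Perm (Fin N)) :
    ω ∘ σ ∈ multislice L N κ x := by
  simp only [multislice, Finset.mem_filter, Fintype.mem_piFinset, Function.comp_apply] at hω ⊢
  refine ⟨fun i => hω.1 _, fun ℓ => ?_⟩
  rw [← hω.2 ℓ]
  exact Finset.card_equiv σ (by simp)

theorem exists_perm_of_mem_multislice {L N : ℕ} {κ : Fin L → ℕ} {x : Fin L → ℝ}
    {ω ω' : Fin N → ℝ} (hω : ω ∈ multislice L N κ x) (hω' : ω' ∈ multislice L N κ x) :
    ∃ σ : Equiv.Perm (Fin N), ω ∘ σ = ω' := by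
  simp only [multislice, Finset.mem_filter, Fintype.mem_piFinset, Finset.mem_image,
    Finset.mem_univ, true_and] at hω hω'
  have h : ∀ c, Nonempty ({i // ω' i = c} ≃ {i // ω i = c}) := fun c => by
    rw [← Fintype.card_eq, Fintype.card_subtype, Fintype.card_subtype]
    by_cases hc : ∃ ℓ, x ℓ = c
    · obtain ⟨ℓ, rfl⟩ := hc
      rw [hω.2, hω'.2]
    · rw [Finset.filter_eq_empty_iff.2 fun i _ (hi : ω' i = c) => hc (hi ▸ hω'.1 i),
        Finset.filter_eq_empty_iff.2 fun i _ (hi : ω i = c) => hc (hi ▸ hω.1 i)]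
  exact ⟨Equiv.ofFiberEquiv fun c => (h c).some,
    funext fun i => Equiv.ofFiberEquiv_map (fun c => (h c).some) i⟩

/-- Averaging over all rearrangements of a point of the multislice is the uniform expectation. -/
theorem sum_perm_comp_eq {L N : ℕ} {κ : Fin L → ℕ} {x : Fin L → ℝ} {ω : Fin N → ℝ}
    (hω : ω ∈ multislice L N κ x) (F : (Fin N → ℝ) → ℝ) :
    ∑ σ : Equiv.Perm (Fin N), F (ω ∘ σ) = N.factorial * uexpect (multislice L N κ x) F := by
  have hconst : ∀ ω' ∈ multislice L N κ x,
      ∑ σ : Equiv.Perm (Fin N), F (ω' ∘ σ) = ∑ σ : Equiv.Perm (Fin N), F (ω ∘ σ) := by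
    intro ω' hω'
    obtain ⟨τ, rfl⟩ := exists_perm_of_mem_multislice hω hω'
    exact Equiv.sum_comp (Equiv.mulLeft τ) fun σ : Equiv.Perm (Fin N) => F (ω ∘ σ)
  have hinv : ∀ σ : Equiv.Perm (Fin N),
      ∑ ω' ∈ multislice L N κ x, F (ω' ∘ σ) = ∑ ω' ∈ multislice L N κ x, F ω' := fun σ =>
    Finset.sum_nbij' (fun ω' => ω' ∘ σ) (fun ω' => ω' ∘ σ.symm)
      (fun _ h => mem_multislice_comp h σ) (fun _ h => mem_multislice_comp h σ.symm)
      (fun _ _ => by ext; simp) (fun _ _ => by ext; simp) (fun _ _ => rfl)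
  have h := Finset.sum_congr rfl hconst
  rw [Finset.sum_comm, Finset.sum_congr rfl fun σ _ => hinv σ] at h
  simp only [Finset.sum_const, Finset.card_univ, Fintype.card_perm, Fintype.card_fin,
    nsmul_eq_mul] at h
  have hc : ((multislice L N κ x).card : ℝ) ≠ 0 := by
    exact_mod_cast (Finset.card_pos.2 ⟨ω, hω⟩).ne'
  rw [uexpect, ← mul_div_assoc, h]
  field_simp

theorem sum_sum_eq_two_mul_sum_lt {n : ℕ} (W : Fin n → Fin n → ℝ) (h0 : ∀ a, W a a = 0)
    (hs : ∀ a b, W a b = W b a) :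
    ∑ a, ∑ b, W a b =
      2 * ∑ q ∈ (Finset.univ : Finset (Fin n × Fin n)).filter (fun q => q.1 < q.2),
        W q.1 q.2 := by
  rw [← Fintype.sum_prod_type', ← Finset.sum_filter_add_sum_filter_not _ (fun q => q.1 < q.2),
    two_mul]
  congr 1
  have : ∑ q ∈ (Finset.univ : Finset (Fin n × Fin n)).filter (fun q => q.1 < q.2), W q.1 q.2 =
      ∑ q ∈ (Finset.univ : Finset (Fin n × Fin n)).filter (fun q => q.2 < q.1), W q.1 q.2 :=
    Finset.sum_nbij' Prod.swap Prod.swap (by simp) (by simp) (by simp) (by simp)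
      (fun q _ => hs _ _)
  rw [this]
  symm
  refine Finset.sum_subset (fun q => by simpa using le_of_lt) fun q hq hq' => ?_
  simp only [Finset.mem_filter, Finset.mem_univ, true_and, not_lt] at hq hq'
  rw [le_antisymm hq' hq]
  exact h0 _

/-- Beckner inequality for the multislice with constant `β_p = 4N/(p(N+2))`. -/
theorem stmt16 (L N : ℕ) (hL : 2 ≤ L) (κ : Fin L → ℕ) (hκ : ∀ ℓ, 1 ≤ κ ℓ)
    (hN : N = ∑ ℓ, κ ℓ) (x : Fin L → ℝ) (hx : StrictMono x)
    (p : ℝ) (hp₁ : 1 < p) (hp₂ : p ≤ 2)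
    (f : (Fin N → ℝ) → ℝ) (hf : ∀ ω ∈ multislice L N κ x, 0 ≤ f ω) :
    uexpect (multislice L N κ x) (fun ω => f ω ^ p) -
        uexpect (multislice L N κ x) f ^ p ≤
      (4 * (N : ℝ) / (p * ((N : ℝ) + 2))) * p / 2 *
        msDirichlet L N κ x f (fun ω => f ω ^ (p - 1)) := by
  rcases (multislice L N κ x).eq_empty_or_nonempty with hΩ | ⟨ω, hω⟩
  · simp [hΩ, uexpect, msDirichlet, Real.zero_rpow (by linarith : p ≠ 0)]
  have hN0 : (0 : ℝ) < N := by
    have h1 : κ ⟨0, by omega⟩ ≤ N := hN ▸ Finset.single_le_sum (f := κ) (by simp) (by simp)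
    exact_mod_cast (hκ _).trans h1
  have hm : (0 : ℝ) < N.factorial := by exact_mod_cast N.factorial_pos
  have hB := permBeckner (r := p - 1) (by linarith) (by linarith) N (fun σ => f (ω ∘ σ))
    fun σ => hf _ (mem_multislice_comp hω σ)
  have hW : ∀ a b, permGap (p - 1) (fun σ : Equiv.Perm (Fin N) => f (ω ∘ σ)) a b =
      N.factorial * uexpect (multislice L N κ x) fun ω =>
        (f ω - f (ω ∘ Equiv.swap a b)) *
          (f ω ^ (p - 1) - f (ω ∘ Equiv.swap a b) ^ (p - 1)) := fun a b =>
    sum_perm_comp_eq hω fun ω => (f ω - f (ω ∘ Equiv.swap a b)) *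
      (f ω ^ (p - 1) - f (ω ∘ Equiv.swap a b) ^ (p - 1))
  rw [sum_sum_eq_two_mul_sum_lt _ (permGap_self _ _) (permGap_comm _ _), sub_add_cancel,
    sum_perm_comp_eq hω fun ω => f ω ^ p, sum_perm_comp_eq hω f,
    mul_div_cancel_left₀ _ hm.ne'] at hB
  simp only [hW, ← Finset.mul_sum] at hB
  rw [msDirichlet]
  generalize (∑ q ∈ (Finset.univ : Finset (Fin N × Fin N)).filter (fun q => q.1 < q.2),
    uexpect (multislice L N κ x) fun ω => (f ω - f (ω ∘ Equiv.swap q.1 q.2)) *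
      (f ω ^ (p - 1) - f (ω ∘ Equiv.swap q.1 q.2) ^ (p - 1))) = W at *
  have e : 4 * (N : ℝ) / (p * (N + 2)) * p / 2 * (1 / (2 * N) * W) = 1 / (N + 2) * W := by
    have : p ≠ 0 := by linarith
    field_simp
    ring
  rw [e]
  refine le_of_mul_le_mul_left ?_ hm
  calc _ = _ := mul_sub _ _ _
    _ ≤ _ := hB
    _ = _ := by field_simp
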